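/- If the assumption ‖H_i‖ = 1 is dropped (H_1 is an arbitrary nonzero traceless local term of the translationally invariant Hamiltonian), the average entanglement entropy of all eigenstates satisfies S̄ ≤ m·ln 2 − f·⟨H_1²⟩/(4‖H_1‖²). -/

import Mathlib

open Finset Matrix
open scoped ComplexOrder

noncomputable section

/-- The Hilbert space of a chain of `n` spin-1/2's, `(ℂ²)^{⊗n}`, in the computational basis:
a state assigns an amplitude to each configuration `Fin n → Fin 2`. -/
abbrev QState (n : ℕ) : Type := (Fin n → Fin 2) → ℂ

/-- Operators on the chain of `n` spin-1/2's. -/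
abbrev QOp (n : ℕ) : Type := Matrix (Fin n → Fin 2) (Fin n → Fin 2) ℂ

/-- von Neumann entropy `S(ρ) = -tr(ρ ln ρ)` (natural logarithm), via eigenvalues. -/
noncomputable def vnEntropy {ι : Type} [Fintype ι] [DecidableEq ι] (ρ : Matrix ι ι ℂ) : ℝ := by
  classical
  exact if h : ρ.IsHermitian then -∑ i, h.eigenvalues i * Real.log (h.eigenvalues i) else 0

/-- Operator norm (`ℓ² → ℓ²`) of a matrix. -/
noncomputable def opNorm {ι : Type} [Fintype ι] [DecidableEq ι] (M : Matrix ι ι ℂ) : ℝ :=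
  ‖LinearMap.toContinuousLinearMap (Matrix.toEuclideanLin M)‖

/-- Combine a configuration of the first `m` sites with one of the remaining `n - m` sites. -/
def joinCfg (n m : ℕ) (a : Fin m → Fin 2) (b : Fin (n - m) → Fin 2) : Fin n → Fin 2 :=
  fun i => if hi : (i : ℕ) < m then a ⟨i, hi⟩ else b ⟨(i : ℕ) - m, by have := i.isLt; omega⟩

/-- Reduced density matrix `ρ_A = tr_B |ψ⟩⟨ψ|` of a pure state, where `A` consists of the
first `m` spins and `B` of the remaining `n - m` spins. -/
noncomputable def rdm (n m : ℕ) (ψ : QState n) :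
    Matrix (Fin m → Fin 2) (Fin m → Fin 2) ℂ :=
  fun a a' => ∑ b : Fin (n - m) → Fin 2,
    ψ (joinCfg n m a b) * (starRingEnd ℂ) (ψ (joinCfg n m a' b))

/-- Entanglement entropy of a pure state between the first `m` spins and the rest. -/
noncomputable def entEntropy (n m : ℕ) (ψ : QState n) : ℝ := vnEntropy (rdm n m ψ)

/-- The cyclic successor `i + 1 (mod n)` of a site of the periodic chain. -/
def finSucc {n : ℕ} (i : Fin n) : Fin n := ⟨((i : ℕ) + 1) % n, Nat.mod_lt _ i.pos⟩

/-- Translation (cyclic shift by one site) acting on configurations. -/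
def shiftCfg {n : ℕ} (σ : Fin n → Fin 2) : Fin n → Fin 2 := fun i => σ (finSucc i)

/-- `M` acts only on the sites in `S`, i.e. `M = K ⊗ 1` with `K` supported on `S`:
matrix elements vanish unless the configurations agree off `S`, and they depend only on
the restriction of the configurations to `S`. -/
def ActsOn {n : ℕ} (S : Finset (Fin n)) (M : QOp n) : Prop :=
  (∀ σ τ : Fin n → Fin 2, (∃ i ∉ S, σ i ≠ τ i) → M σ τ = 0) ∧
  (∀ σ τ σ' τ' : Fin n → Fin 2, (∀ i ∈ S, σ i = σ' i) → (∀ i ∈ S, τ i = τ' i) →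
    (∀ i ∉ S, σ i = τ i) → (∀ i ∉ S, σ' i = τ' i) → M σ τ = M σ' τ')

lemma gibbs_term (p f Z : ℝ) (hp : 0 ≤ p) (hZ0 : 0 < Z) :
    p * f - p * Real.log p - p * Real.log Z ≤ Real.exp f / Z - p := by
  rcases hp.eq_or_lt with h | h
  · rw [← h]
    have : 0 ≤ Real.exp f / Z := by positivity
    simpa using this
  · have := Real.log_le_sub_one_of_pos (x := Real.exp f / (p * Z)) (by positivity)
    rw [Real.log_div (by positivity) (by positivity), Real.log_exp, Real.log_mul h.ne' hZ0.ne'] at this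
    have h5 := mul_le_mul_of_nonneg_left this h.le
    have h6 : p * (Real.exp f / (p * Z) - 1) = Real.exp f / Z - p := by
      field_simp
    linarith

lemma vnEntropy_le {ι κ : Type} [Fintype ι] [DecidableEq ι] [Fintype κ] [DecidableEq κ] [Nonempty κ]
    (ρ : Matrix ι ι ℂ) (hρ : ρ.PosSemidef) (htr : ρ.trace = 1) (W : Matrix ι κ ℂ)
    (h1 : W * Wᴴ = 1) (h2 : Wᴴ * W = 1) (f : κ → ℝ) :
    vnEntropy ρ + (ρ * (W * diagonal (fun l => (f l : ℂ)) * Wᴴ)).trace.re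
      ≤ Real.log (∑ l, Real.exp (f l)) := by
  classical
  have hH := hρ.isHermitian
  have hS : vnEntropy ρ = -∑ i, hH.eigenvalues i * Real.log (hH.eigenvalues i) := by
    unfold vnEntropy
    rw [dif_pos hH]
  rw [hS]
  set p := hH.eigenvalues with hp
  have hp0 : ∀ i, 0 ≤ p i := fun i => hρ.eigenvalues_nonneg i
  have hp1 : ∑ i, p i = 1 := by
    have := hH.trace_eq_sum_eigenvalues
    rw [htr] at this
    have h3 : ((∑ i, p i : ℝ) : ℂ) = 1 := by push_cast; exact this.symm
    exact_mod_cast h3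
  set U : Matrix ι ι ℂ := (hH.eigenvectorUnitary : Matrix ι ι ℂ) with hU
  have hU1 : U * Uᴴ = 1 := by
    have := Unitary.coe_mul_star_self hH.eigenvectorUnitary
    simpa [star_eq_conjTranspose] using this
  have hU2 : Uᴴ * U = 1 := by
    have := Unitary.coe_star_mul_self hH.eigenvectorUnitary
    simpa [star_eq_conjTranspose] using this
  have hspec : ρ = U * diagonal (fun i => (p i : ℂ)) * Uᴴ := by
    have := hH.spectral_theorem
    rw [Unitary.conjStarAlgAut_apply] at this
    simpa [star_eq_conjTranspose, Function.comp_def] using this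
  set X : Matrix κ ι ℂ := Wᴴ * U with hX
  have hX1 : X * Xᴴ = 1 := by
    rw [hX, conjTranspose_mul, conjTranspose_conjTranspose, Matrix.mul_assoc, ← Matrix.mul_assoc U,
      hU1, Matrix.one_mul, h2]
  have hX2 : Xᴴ * X = 1 := by
    rw [hX, conjTranspose_mul, conjTranspose_conjTranspose, Matrix.mul_assoc, ← Matrix.mul_assoc W,
      h1, Matrix.one_mul, hU2]
  have hP1 : ∀ l, ∑ i, Complex.normSq (X l i) = 1 := by
    intro l
    have := congrFun (congrFun hX1 l) l
    simp only [mul_apply, conjTranspose_apply, one_apply_eq, RCLike.star_def, Complex.mul_conj] at this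
    exact_mod_cast this
  have hP2 : ∀ i, ∑ l, Complex.normSq (X l i) = 1 := by
    intro l
    have := congrFun (congrFun hX2 l) l
    simp only [mul_apply, conjTranspose_apply, one_apply_eq, RCLike.star_def, mul_comm _ (X _ _), Complex.mul_conj] at this
    exact_mod_cast this
  have hT : (ρ * (W * diagonal (fun l => (f l : ℂ)) * Wᴴ)).trace
      = ((∑ l, ∑ i, Complex.normSq (X l i) * (p i * f l) : ℝ) : ℂ) := by
    have e1 : (ρ * (W * diagonal (fun l => (f l : ℂ)) * Wᴴ)).trace
        = (X * diagonal (fun i => (p i : ℂ)) * (Xᴴ * diagonal (fun l => (f l : ℂ)))).trace := by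
      rw [hspec, hX, conjTranspose_mul, conjTranspose_conjTranspose]
      rw [← Matrix.mul_assoc, Matrix.trace_mul_comm]
      simp only [Matrix.mul_assoc]
    rw [e1, trace]
    push_cast
    refine Finset.sum_congr rfl fun l _ => ?_
    rw [diag_apply, mul_apply]
    refine Finset.sum_congr rfl fun i _ => ?_
    rw [mul_diagonal, mul_diagonal, conjTranspose_apply, RCLike.star_def,
      ← Complex.mul_conj]
    ring
  rw [hT, Complex.ofReal_re]
  set Z := ∑ l, Real.exp (f l) with hZ
  have hZ0 : 0 < Z := Finset.sum_pos (fun l _ => Real.exp_pos _) Finset.univ_nonempty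
  have key : ∀ l i, p i * f l - p i * Real.log (p i) - p i * Real.log Z ≤ Real.exp (f l) / Z - p i :=
    fun l i => gibbs_term (p i) (f l) Z (hp0 i) hZ0
  have hsum : ∑ l, ∑ i, Complex.normSq (X l i) * (p i * f l - p i * Real.log (p i) - p i * Real.log Z)
      ≤ ∑ l, ∑ i, Complex.normSq (X l i) * (Real.exp (f l) / Z - p i) :=
    Finset.sum_le_sum fun l _ => Finset.sum_le_sum fun i _ =>
      mul_le_mul_of_nonneg_left (key l i) (Complex.normSq_nonneg _)
  have A : ∀ g : ι → ℝ, ∑ l, ∑ i, Complex.normSq (X l i) * g i = ∑ i, g i := by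
    intro g
    rw [Finset.sum_comm]
    refine Finset.sum_congr rfl fun i _ => ?_
    rw [← Finset.sum_mul, hP2, one_mul]
  have B : ∀ g : κ → ℝ, ∑ l, ∑ i, Complex.normSq (X l i) * g l = ∑ l, g l := by
    intro g
    refine Finset.sum_congr rfl fun i _ => ?_
    rw [← Finset.sum_mul, hP1, one_mul]
  simp only [mul_sub, Finset.sum_sub_distrib] at hsum
  rw [A (fun i => p i * Real.log (p i)), A (fun i => p i * Real.log Z), A p,
    B (fun l => Real.exp (f l) / Z), ← Finset.sum_mul, ← Finset.sum_div, hp1, ← hZ, div_self hZ0.ne'] at hsum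
  linarith

lemma hoeffding_sum {κ : Type} [Fintype κ] (x : κ → ℝ) (N t : ℝ) (hN : 0 ≤ N)
    (h0 : ∑ y, x y = 0) (hb : ∀ y, |x y| ≤ N) :
    ∑ y, Real.exp (t * x y) ≤ Fintype.card κ * Real.exp (t ^ 2 * N ^ 2 / 2) := by
  rcases hN.eq_or_lt with h | h
  · have : ∀ y, x y = 0 := fun y => by
      have := hb y
      rw [← h] at this
      exact abs_nonpos_iff.mp this
    simp [this, ← h]
  have key : ∀ y, Real.exp (t * x y) ≤ Real.cosh (t * N) + x y / N * Real.sinh (t * N) := by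
    intro y
    have hy := abs_le.mp (hb y)
    have c1 : (0:ℝ) ≤ (1 + x y / N) / 2 := by
      have : -1 ≤ x y / N := by rw [le_div_iff₀ h]; linarith
      linarith
    have c2 : (0:ℝ) ≤ (1 - x y / N) / 2 := by
      have : x y / N ≤ 1 := by rw [div_le_iff₀ h]; linarith
      linarith
    have hc := convexOn_exp.2 (Set.mem_univ (t * N)) (Set.mem_univ (-(t * N))) c1 c2 (by ring)
    simp only [smul_eq_mul] at hc
    rw [show (1 + x y / N) / 2 * (t * N) + (1 - x y / N) / 2 * -(t * N) = t * x y by field_simp; ring] at hc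
    refine hc.trans (le_of_eq ?_)
    rw [Real.cosh_eq, Real.sinh_eq]; ring
  calc ∑ y, Real.exp (t * x y) ≤ ∑ y, (Real.cosh (t * N) + x y / N * Real.sinh (t * N)) :=
        Finset.sum_le_sum fun y _ => key y
    _ = Fintype.card κ * Real.cosh (t * N) := by
        rw [Finset.sum_add_distrib, ← Finset.sum_mul, ← Finset.sum_div, h0]; simp
    _ ≤ _ := by
        have := Real.cosh_le_exp_half_sq (t * N)
        rw [mul_pow] at this
        gcongr

/-- split configuration of `r + r` spins into pairs -/
def pairEquiv (r : ℕ) : (Fin (r + r) → Fin 2) ≃ (Fin r → Fin 2 × Fin 2) where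
  toFun a k := (a ⟨2 * k, by omega⟩, a ⟨2 * k + 1, by omega⟩)
  invFun g i := if (i : ℕ) % 2 = 0 then (g ⟨i / 2, by omega⟩).1 else (g ⟨i / 2, by omega⟩).2
  left_inv a := by
    funext i
    dsimp only
    split_ifs with h
    · congr 1; ext; simp; omega
    · congr 1; ext; simp; omega
  right_inv g := by
    funext k
    have h1 : (2 * (k : ℕ) + 1) / 2 = k := by omega
    have h2 : (2 * (k : ℕ)) / 2 = k := by omega
    ext <;> simp [h1, h2, Nat.add_mod]

def joinEquiv (n m : ℕ) (h : m ≤ n) :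
    (Fin m → Fin 2) × (Fin (n - m) → Fin 2) ≃ (Fin n → Fin 2) where
  toFun x := joinCfg n m x.1 x.2
  invFun σ := (fun i => σ ⟨i, by omega⟩, fun i => σ ⟨i + m, by omega⟩)
  left_inv x := by
    ext i <;> simp [joinCfg]
  right_inv σ := by
    funext i
    simp only [joinCfg]
    split_ifs with h
    · rfl
    · congr 1; ext; simp; omega

section prodbasis
variable {P ι : Type} [Fintype P] [DecidableEq P] [Fintype ι] [DecidableEq ι] {r : ℕ}

/-- product basis -/
def prodBasis (e : ι ≃ (Fin r → P)) (w : Matrix P P ℂ) : Matrix ι (Fin r → P) ℂ :=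
  fun a l => ∏ k, w (e a k) (l k)

lemma prodBasis_mul (e : ι ≃ (Fin r → P)) (w : Matrix P P ℂ) (hw : w * wᴴ = 1) :
    prodBasis e w * (prodBasis e w)ᴴ = 1 := by
  ext a a'
  have hw' : ∀ x x', ∑ y, w x y * star (w x' y) = if x = x' then 1 else 0 := fun x x' => by
    have := congrFun (congrFun hw x) x'
    simpa [mul_apply, one_apply] using this
  simp only [mul_apply, conjTranspose_apply, prodBasis, star_prod, ← Finset.prod_mul_distrib]
  rw [← Fintype.prod_sum (fun k y => w (e a k) y * star (w (e a' k) y))]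
  simp only [hw', one_apply]
  rw [Finset.prod_ite_zero]
  simp [← funext_iff]

lemma prodBasis_mul' (e : ι ≃ (Fin r → P)) (w : Matrix P P ℂ) (hw : wᴴ * w = 1) :
    (prodBasis e w)ᴴ * prodBasis e w = 1 := by
  ext a a'
  have hw' : ∀ x x', ∑ y, star (w y x) * (w y x') = if x = x' then 1 else 0 := fun x x' => by
    have := congrFun (congrFun hw x) x'
    simpa [mul_apply, one_apply] using this
  simp only [mul_apply, conjTranspose_apply, prodBasis, star_prod, ← Finset.prod_mul_distrib]
  rw [e.sum_comp (fun l => ∏ k, star (w (l k) (a k)) * w (l k) (a' k))]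
  rw [← Fintype.prod_sum (fun k y => star (w y (a k)) * (w y (a' k)))]
  simp only [hw', one_apply]
  rw [Finset.prod_ite_zero]
  simp [← funext_iff]

lemma prodBasis_diag (e : ι ≃ (Fin r → P)) (w : Matrix P P ℂ) (hw : w * wᴴ = 1) (x : P → ℝ)
    (h : Matrix P P ℂ) (hh : h = w * diagonal (fun y => (x y : ℂ)) * wᴴ) (t : ℝ) :
    (prodBasis e w * (diagonal (fun l => ((∑ k, t * x (l k) : ℝ) : ℂ)) : Matrix (Fin r → P) (Fin r → P) ℂ) * (prodBasis e w)ᴴ : Matrix ι ι ℂ)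
      = Matrix.of fun a a' => (t : ℂ) * ∑ k, if (∀ k', k' ≠ k → e a k' = e a' k') then h (e a k) (e a' k) else 0 := by
  ext a a'
  have hw' : ∀ x x', ∑ y, w x y * star (w x' y) = if x = x' then 1 else 0 := fun x x' => by
    have := congrFun (congrFun hw x) x'
    simpa [mul_apply, one_apply] using this
  have hh' : ∀ z z', ∑ y, w z y * star (w z' y) * (x y : ℂ) = h z z' := fun z z' => by
    rw [hh]
    simp only [mul_apply (M := w * _), mul_diagonal, conjTranspose_apply]
    exact Finset.sum_congr rfl fun _ _ => by ring
  rw [Matrix.of_apply]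
  rw [mul_apply]
  simp only [mul_diagonal, conjTranspose_apply, prodBasis, star_prod]
  push_cast
  simp only [Finset.mul_sum, Finset.sum_mul]
  rw [Finset.sum_comm]
  refine Finset.sum_congr rfl fun k _ => ?_
  have : ∀ l : Fin r → P, (∏ k, w (e a k) (l k)) * ((t : ℂ) * (x (l k) : ℂ)) * ∏ k, star (w (e a' k) (l k))
      = t * ∏ k', (w (e a k') (l k') * star (w (e a' k') (l k')) * if k' = k then (x (l k') : ℂ) else 1) := by
    intro l
    rw [Finset.prod_mul_distrib, Finset.prod_mul_distrib, Finset.prod_ite_eq']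
    simp; ring
  simp only [this]
  rw [← Finset.mul_sum, ← Fintype.prod_sum (fun k' y => (w (e a k') y * star (w (e a' k') y) * if k' = k then (x y : ℂ) else 1))]
  congr 1
  have h3 : ∀ k', (∑ y, (w (e a k') y * star (w (e a' k') y) * if k' = k then (x y : ℂ) else 1))
      = if k' = k then h (e a k') (e a' k') else if e a k' = e a' k' then 1 else 0 := by
    intro k'
    by_cases h1 : k' = k
    · simp only [if_pos h1]
      exact hh' _ _
    · simp only [if_neg h1, mul_one]
      exact hw' _ _
  simp only [h3]
  rw [← Finset.mul_prod_erase _ _ (Finset.mem_univ k)]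
  rw [Finset.prod_congr rfl (g := fun k' => if e a k' = e a' k' then (1:ℂ) else 0)
    (fun k' hk' => by rw [if_neg (Finset.ne_of_mem_erase hk')])]
  rw [Finset.prod_ite_zero]
  simp

lemma sum_exp_prod (x : P → ℝ) (t : ℝ) :
    ∑ l : Fin r → P, Real.exp (∑ k, t * x (l k)) = (∑ y, Real.exp (t * x y)) ^ r := by
  simp only [Real.exp_sum]
  rw [← Fintype.prod_sum (fun (k : Fin r) y => Real.exp (t * x y))]
  simp
end prodbasis

lemma ActsOn.mono' {n : ℕ} {S T : Finset (Fin n)} (hST : S ⊆ T) {M : QOp n} (h : ActsOn S M) :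
    ActsOn T M := by
  refine ⟨fun σ τ ⟨i, hi, hne⟩ => h.1 σ τ ⟨i, fun hS => hi (hST hS), hne⟩, ?_⟩
  intro σ τ σ' τ' h1 h2 h3 h4
  by_cases hc : ∀ i ∉ S, σ i = τ i
  · refine h.2 σ τ σ' τ' (fun i hi => h1 i (hST hi)) (fun i hi => h2 i (hST hi)) hc ?_
    intro i hi
    by_cases hT : i ∈ T
    · rw [← h1 i hT, ← h2 i hT]; exact hc i hi
    · exact h4 i hT
  · push Not at hc
    obtain ⟨i, hi, hne⟩ := hc
    have hT : i ∈ T := by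
      by_contra hT
      exact hne (h3 i hT)
    rw [h.1 σ τ ⟨i, hi, hne⟩, h.1 σ' τ' ⟨i, hi, by rw [← h1 i hT, ← h2 i hT]; exact hne⟩]

lemma ActsOn.add' {n : ℕ} {S : Finset (Fin n)} {M M' : QOp n} (h : ActsOn S M) (h' : ActsOn S M') :
    ActsOn S (M + M') := by
  refine ⟨fun σ τ hh => by rw [Matrix.add_apply, h.1 σ τ hh, h'.1 σ τ hh, add_zero], ?_⟩
  intro σ τ σ' τ' h1 h2 h3 h4
  rw [Matrix.add_apply, Matrix.add_apply, h.2 σ τ σ' τ' h1 h2 h3 h4, h'.2 σ τ σ' τ' h1 h2 h3 h4]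

/-- local block of an operator on the first two sites -/
def locMat (n : ℕ) (M : QOp n) : Matrix (Fin 2 × Fin 2) (Fin 2 × Fin 2) ℂ :=
  Matrix.of fun x y => M (joinCfg n 2 ![x.1, x.2] 0) (joinCfg n 2 ![y.1, y.2] 0)

lemma local_apply {n : ℕ} (hn : 2 ≤ n) (M : QOp n)
    (hM : ActsOn {(⟨0, by omega⟩ : Fin n), ⟨1, by omega⟩} M) (σ τ : Fin n → Fin 2) :
    M σ τ = if (∀ i : Fin n, 2 ≤ (i : ℕ) → σ i = τ i) then
      locMat n M (σ ⟨0, by omega⟩, σ ⟨1, by omega⟩) (τ ⟨0, by omega⟩, τ ⟨1, by omega⟩) else 0 := by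
  split_ifs with h
  · rw [locMat, of_apply]
    have hne : ∀ i : Fin n, i ∉ ({(⟨0, by omega⟩ : Fin n), ⟨1, by omega⟩} : Finset (Fin n)) → 2 ≤ (i : ℕ) := by
      intro i hi
      simp [Fin.ext_iff] at hi
      omega
    apply hM.2
    · intro i hi
      simp at hi
      rcases hi with rfl | rfl <;> simp [joinCfg]
    · intro i hi
      simp at hi
      rcases hi with rfl | rfl <;> simp [joinCfg]
    · intro i hi
      exact h i (hne i hi)
    · intro i hi
      have := hne i hi
      simp [joinCfg, show ¬ (i : ℕ) < 2 by omega]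
  · push Not at h
    obtain ⟨i, hi, h⟩ := h
    refine hM.1 σ τ ⟨i, ?_, h⟩
    simp [Fin.ext_iff]; omega

lemma local_apply_join {n : ℕ} (hn : 2 ≤ n) (M : QOp n)
    (hM : ActsOn {(⟨0, by omega⟩ : Fin n), ⟨1, by omega⟩} M) (a a' : Fin 2 → Fin 2)
    (b b' : Fin (n - 2) → Fin 2) :
    M (joinCfg n 2 a b) (joinCfg n 2 a' b') = if b = b' then
      locMat n M (a 0, a 1) (a' 0, a' 1) else 0 := by
  rw [local_apply hn M hM]
  have : (∀ i : Fin n, 2 ≤ (i : ℕ) → joinCfg n 2 a b i = joinCfg n 2 a' b' i) ↔ b = b' := by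
    constructor
    · intro h
      funext i
      have := h ⟨i + 2, by omega⟩ (by simp)
      simpa [joinCfg] using this
    · rintro rfl i hi
      simp [joinCfg, show ¬ (i : ℕ) < 2 by omega]
  simp only [this]
  rfl

lemma locMat_trace {n : ℕ} (hn : 2 ≤ n) (M : QOp n)
    (hM : ActsOn {(⟨0, by omega⟩ : Fin n), ⟨1, by omega⟩} M) (h0 : M.trace = 0) :
    (locMat n M).trace = 0 := by
  rw [trace, ← (joinEquiv n 2 hn).sum_comp, Fintype.sum_prod_type] at h0
  simp only [joinEquiv, Equiv.coe_fn_mk, diag_apply, local_apply_join hn M hM, if_true] at h0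
  rw [Finset.sum_comm, Finset.sum_const] at h0
  have h1 : ∑ a : Fin 2 → Fin 2, locMat n M (a 0, a 1) (a 0, a 1) = 0 := by
    simpa using h0
  rw [trace, ← (finTwoArrowEquiv (Fin 2)).sum_comp]
  exact h1

lemma locMat_eig {n : ℕ} (hn : 2 ≤ n) (M : QOp n)
    (hM : ActsOn {(⟨0, by omega⟩ : Fin n), ⟨1, by omega⟩} M) (u : Fin 2 × Fin 2 → ℂ) (hu : u ≠ 0)
    (x : ℝ) (hx : locMat n M *ᵥ u = (x : ℂ) • u) : |x| ≤ opNorm M := by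
  set ψ : EuclideanSpace ℂ (Fin n → Fin 2) :=
    WithLp.toLp 2 (fun σ => u (σ ⟨0, by omega⟩, σ ⟨1, by omega⟩)) with hψ
  have hψ0 : ψ ≠ 0 := by
    intro h
    apply hu
    funext y
    have := congrArg (fun z : EuclideanSpace ℂ (Fin n → Fin 2) => z (joinCfg n 2 ![y.1, y.2] 0)) h
    simpa [hψ, joinCfg] using this
  have hE : Matrix.toEuclideanLin M ψ = (x : ℂ) • ψ := by
    ext σ
    obtain ⟨⟨a, b⟩, rfl⟩ := (joinEquiv n 2 hn).surjective σ
    have h2 := congrFun hx (a 0, a 1)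
    simp only [mulVec, dotProduct, Pi.smul_apply] at h2
    rw [← (finTwoArrowEquiv (Fin 2)).sum_comp] at h2
    have h3 : (Matrix.toEuclideanLin M ψ) (joinEquiv n 2 hn (a, b))
        = ∑ τ, M (joinEquiv n 2 hn (a, b)) τ * u (τ ⟨0, by omega⟩, τ ⟨1, by omega⟩) := rfl
    rw [h3, ← (joinEquiv n 2 hn).sum_comp, Fintype.sum_prod_type]
    simp only [joinEquiv, Equiv.coe_fn_mk, local_apply_join hn M hM]
    simp only [ite_mul, zero_mul, Finset.sum_ite_eq, Finset.mem_univ, if_true]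
    exact h2
  have h4 := (LinearMap.toContinuousLinearMap (Matrix.toEuclideanLin M)).le_opNorm ψ
  rw [LinearMap.coe_toContinuousLinearMap', hE, norm_smul] at h4
  have h5 := le_of_mul_le_mul_right h4 (norm_pos_iff.mpr hψ0)
  simpa [opNorm] using h5

lemma rdm_eq (n m : ℕ) (ψ : QState n) :
    rdm n m ψ = (Matrix.of fun a b => ψ (joinCfg n m a b) : Matrix _ (Fin (n - m) → Fin 2) ℂ) *
      (Matrix.of fun a b => ψ (joinCfg n m a b) : Matrix _ (Fin (n - m) → Fin 2) ℂ)ᴴ := by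
  ext a a'
  simp [rdm, mul_apply]

lemma rdm_psd (n m : ℕ) (ψ : QState n) : (rdm n m ψ).PosSemidef := by
  rw [rdm_eq]
  exact posSemidef_self_mul_conjTranspose _

lemma rdm_trace (n m : ℕ) (hm : m ≤ n) (ψ : QState n) (K : Matrix (Fin m → Fin 2) (Fin m → Fin 2) ℂ)
    (M : QOp n) (hM : ∀ a b a' b', M (joinCfg n m a b) (joinCfg n m a' b') = if b = b' then K a a' else 0) :
    (rdm n m ψ * K).trace = ∑ σ, ∑ τ, (starRingEnd ℂ) (ψ σ) * M σ τ * ψ τ := by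
  rw [← (joinEquiv n m hm).sum_comp, Fintype.sum_prod_type]
  simp only [← (joinEquiv n m hm).sum_comp (fun τ => _ * M _ τ * ψ τ), Fintype.sum_prod_type]
  simp only [joinEquiv, Equiv.coe_fn_mk, hM, mul_ite, ite_mul, mul_zero, zero_mul,
    Finset.sum_ite_eq, Finset.mem_univ, if_true]
  simp only [trace, diag_apply, mul_apply, rdm, Finset.sum_mul]
  rw [Finset.sum_comm]
  refine Finset.sum_congr rfl fun a' _ => ?_
  rw [Finset.sum_comm]
  refine Finset.sum_congr rfl fun b _ => ?_
  refine Finset.sum_congr rfl fun a _ => ?_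
  ring

lemma shift_iter {n : ℕ} (hn : 0 < n) (k : ℕ) (σ : Fin n → Fin 2) (i : Fin n) :
    (shiftCfg^[k] σ) i = σ ⟨(i + k) % n, Nat.mod_lt _ hn⟩ := by
  induction k generalizing σ with
  | zero => simp [Nat.mod_eq_of_lt i.isLt]
  | succ k ih =>
    rw [Function.iterate_succ_apply, ih]
    simp only [shiftCfg, finSucc]
    congr 2
    rw [Nat.mod_add_mod, add_assoc]

lemma G_iter {n : ℕ} (hn : 0 < n) (G : Fin n → QOp n)
    (hG : ∀ i σ τ, G (finSucc i) σ τ = G i (shiftCfg σ) (shiftCfg τ)) (k : ℕ) :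
    ∀ σ τ, G ⟨k % n, Nat.mod_lt _ hn⟩ σ τ = G ⟨0, hn⟩ (shiftCfg^[k] σ) (shiftCfg^[k] τ) := by
  induction k with
  | zero => intro σ τ; simp
  | succ k ih =>
    intro σ τ
    have : (⟨(k + 1) % n, Nat.mod_lt _ hn⟩ : Fin n) = finSucc ⟨k % n, Nat.mod_lt _ hn⟩ := by
      simp [finSucc]
    rw [this, hG, ih, Function.iterate_succ_apply, Function.iterate_succ_apply]

lemma finSucc_surj {n : ℕ} : Function.Surjective (finSucc : Fin n → Fin n) := by
  intro i
  by_cases h : (i : ℕ) = 0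
  · refine ⟨⟨n - 1, by omega⟩, ?_⟩
    ext
    simp [finSucc, h, Nat.sub_add_cancel (show 1 ≤ n by omega)]
  · refine ⟨⟨i - 1, by omega⟩, ?_⟩
    ext
    simp [finSucc, Nat.sub_add_cancel (show 1 ≤ (i : ℕ) by omega), Nat.mod_eq_of_lt i.isLt]

lemma shift_bij {n : ℕ} : Function.Bijective (shiftCfg : (Fin n → Fin 2) → (Fin n → Fin 2)) := by
  rw [← Finite.injective_iff_bijective]
  intro σ τ h
  funext i
  obtain ⟨j, rfl⟩ := finSucc_surj i
  exact congrFun h j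

lemma agree_iff {n : ℕ} (hn : 0 < n) (k : ℕ) (hk : k + 1 < n) (σ τ : Fin n → Fin 2) :
    (∀ i : Fin n, 2 ≤ (i : ℕ) → (shiftCfg^[k] σ) i = (shiftCfg^[k] τ) i) ↔
      ∀ j : Fin n, (j : ℕ) ≠ k → (j : ℕ) ≠ k + 1 → σ j = τ j := by
  simp only [shift_iter hn]
  constructor
  · intro h j h1 h2
    by_cases hj : (j : ℕ) < k
    · have := h ⟨j + n - k, by omega⟩ (by simp; omega)
      have e : ((j : ℕ) + n - k + k) % n = j := by
        rw [show (j : ℕ) + n - k + k = j + n by omega, Nat.add_mod_right, Nat.mod_eq_of_lt j.isLt]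
      simpa [e] using this
    · have := h ⟨j - k, by omega⟩ (by simp; omega)
      have e : ((j : ℕ) - k + k) % n = j := by
        rw [show (j : ℕ) - k + k = j by omega, Nat.mod_eq_of_lt j.isLt]
      simpa [e] using this
  · intro h i hi
    have e : ((i : ℕ) + k) % n = if (i : ℕ) + k < n then (i : ℕ) + k else i + k - n := by
      split_ifs with h1
      · exact Nat.mod_eq_of_lt h1
      · rw [Nat.mod_eq_sub_mod (by omega), Nat.mod_eq_of_lt (by omega)]
    apply h <;> simp only [e] <;> split_ifs <;> omega

lemma pair_agree {n r : ℕ} (hr : r + r ≤ n) (k : Fin r) (a a' : Fin (r + r) → Fin 2)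
    (b b' : Fin (n - (r + r)) → Fin 2) :
    (∀ j : Fin n, (j : ℕ) ≠ 2 * k → (j : ℕ) ≠ 2 * k + 1 →
      joinCfg n (r + r) a b j = joinCfg n (r + r) a' b' j) ↔
    (b = b' ∧ ∀ k', k' ≠ k → pairEquiv r a k' = pairEquiv r a' k') := by
  constructor
  · intro h
    constructor
    · funext i
      have := h ⟨i + (r + r), by omega⟩ (by simp; omega) (by simp; omega)
      simpa [joinCfg] using this
    · intro k' hk'
      have hk'' : (k' : ℕ) ≠ k := fun hh => hk' (Fin.ext hh)
      have h1 := h ⟨2 * k', by omega⟩ (by simp; omega) (by simp; omega)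
      have h2 := h ⟨2 * k' + 1, by omega⟩ (by simp; omega) (by simp; omega)
      simp only [joinCfg, show 2 * (k' : ℕ) < r + r by omega, show 2 * (k' : ℕ) + 1 < r + r by omega, dite_true] at h1 h2
      exact Prod.ext h1 h2
  · rintro ⟨rfl, h⟩ j h1 h2
    simp only [joinCfg]
    split_ifs with hj
    · have h3 := h ⟨(j : ℕ) / 2, by omega⟩ (by simp [Fin.ext_iff]; omega)
      simp only [pairEquiv, Equiv.coe_fn_mk, Prod.mk.injEq] at h3
      rcases Nat.mod_two_eq_zero_or_one j with hm | hm
      · have e : 2 * ((j : ℕ) / 2) = j := by omega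
        simpa [e] using h3.1
      · have e : 2 * ((j : ℕ) / 2) + 1 = j := by omega
        simpa [e] using h3.2
    · rfl

lemma rdm_trace_one (n m : ℕ) (hm : m ≤ n) (ψ : QState n) (hψ : ∑ σ, (starRingEnd ℂ) (ψ σ) * ψ σ = 1) :
    (rdm n m ψ).trace = 1 := by
  have := rdm_trace n m hm ψ 1 1 (by
    intro a b a' b'
    have h : joinCfg n m a b = joinCfg n m a' b' ↔ a = a' ∧ b = b' := by
      have := (joinEquiv n m hm).injective.eq_iff (a := (a, b)) (b := (a', b'))
      simpa [joinEquiv] using this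
    simp only [one_apply, h]
    split_ifs <;> simp_all)
  rw [Matrix.mul_one] at this
  rw [this, ← hψ]
  refine Finset.sum_congr rfl fun σ _ => ?_
  simp [one_apply]

lemma ent_bound {n r : ℕ} (hr : 0 < r) (hrn : 2 * (r + r) ≤ n) (M : QOp n)
    (hM : ActsOn {(⟨0, by omega⟩ : Fin n), ⟨1, by omega⟩} M) (hherm : M.IsHermitian)
    (htr : M.trace = 0) (G : Fin r → QOp n)
    (hG : ∀ k σ τ, G k σ τ = M (shiftCfg^[2 * (k : ℕ)] σ) (shiftCfg^[2 * (k : ℕ)] τ))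
    (ψ : QState n) (hψ : ∑ σ, (starRingEnd ℂ) (ψ σ) * ψ σ = 1) (ε : ℝ)
    (hε : ∀ k, ∑ σ, ∑ τ, (starRingEnd ℂ) (ψ σ) * G k σ τ * ψ τ = ε) :
    entEntropy n (r + r) ψ ≤ ((r + r : ℕ) : ℝ) * Real.log 2
      - ((r + r : ℕ) : ℝ) * ε ^ 2 / (4 * opNorm M ^ 2) := by
  have hn2 : 2 ≤ n := by omega
  have hn0 : 0 < n := by omega
  set h := locMat n M with hh
  have hH : h.IsHermitian := by
    ext x y
    have := congrFun (congrFun hherm (joinCfg n 2 ![x.1, x.2] 0)) (joinCfg n 2 ![y.1, y.2] 0)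
    simpa [hh, locMat] using this
  set x := hH.eigenvalues with hx
  set w : Matrix (Fin 2 × Fin 2) (Fin 2 × Fin 2) ℂ := (hH.eigenvectorUnitary : Matrix (Fin 2 × Fin 2) (Fin 2 × Fin 2) ℂ) with hw
  have hw1 : w * wᴴ = 1 := by
    have := Unitary.coe_mul_star_self hH.eigenvectorUnitary
    simpa [star_eq_conjTranspose] using this
  have hw2 : wᴴ * w = 1 := by
    have := Unitary.coe_star_mul_self hH.eigenvectorUnitary
    simpa [star_eq_conjTranspose] using this
  have hspec : h = w * diagonal (fun i => (x i : ℂ)) * wᴴ := by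
    have := hH.spectral_theorem
    rw [Unitary.conjStarAlgAut_apply] at this
    simpa [star_eq_conjTranspose, Function.comp_def] using this
  have hx0 : ∑ y, x y = 0 := by
    have h1 := hH.trace_eq_sum_eigenvalues
    rw [locMat_trace hn2 M hM htr] at h1
    have h3 : ((∑ i, x i : ℝ) : ℂ) = 0 := by push_cast; exact h1.symm
    exact_mod_cast h3
  have hxb : ∀ y, |x y| ≤ opNorm M := by
    intro y
    refine locMat_eig hn2 M hM (hH.eigenvectorBasis y).ofLp ?_ (x y) ?_
    · intro h0
      have h1 : hH.eigenvectorBasis y = 0 := by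
        ext i; exact congrFun h0 i
      exact hH.eigenvectorBasis.toBasis.ne_zero y (by simpa using h1)
    · exact hH.mulVec_eigenvectorBasis y
  set N := opNorm M with hN
  have hN0 : 0 ≤ N := norm_nonneg _
  set t : ℝ := ε / N ^ 2 with ht
  have hnon : Nonempty (Fin r → Fin 2 × Fin 2) := inferInstance
  have key := vnEntropy_le (rdm n (r + r) ψ) (rdm_psd _ _ _) (rdm_trace_one n (r + r) (by omega) ψ hψ)
    (prodBasis (pairEquiv r) w) (prodBasis_mul _ w hw1) (prodBasis_mul' _ w hw2)
    (fun l => ∑ k, t * x (l k))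
  rw [sum_exp_prod] at key
  have hT : (rdm n (r + r) ψ * (prodBasis (pairEquiv r) w *
      (diagonal (fun l => ((∑ k, t * x (l k) : ℝ) : ℂ)) : Matrix (Fin r → Fin 2 × Fin 2) (Fin r → Fin 2 × Fin 2) ℂ) *
      (prodBasis (pairEquiv r) w)ᴴ : Matrix (Fin (r + r) → Fin 2) (Fin (r + r) → Fin 2) ℂ)).trace = ((t * (r * ε) : ℝ) : ℂ) := by
    have e1 := prodBasis_diag (pairEquiv r) w hw1 x h hspec t
    rw [e1, rdm_trace n (r + r) (by omega) ψ _ ((t : ℂ) • ∑ k, G k)]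
    · have : ∀ σ τ, (starRingEnd ℂ) (ψ σ) * ((t : ℂ) • ∑ k, G k) σ τ * ψ τ
          = (t : ℂ) * ∑ k, (starRingEnd ℂ) (ψ σ) * G k σ τ * ψ τ := by
        intro σ τ
        rw [Matrix.smul_apply, Matrix.sum_apply, smul_eq_mul, Finset.mul_sum, Finset.mul_sum, Finset.sum_mul, Finset.mul_sum]
        exact Finset.sum_congr rfl fun _ _ => by ring
      simp only [this, ← Finset.mul_sum]
      have h2 : ∑ σ, ∑ τ, ∑ k, (starRingEnd ℂ) (ψ σ) * G k σ τ * ψ τ = ∑ k : Fin r, (ε : ℂ) := by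
        rw [Finset.sum_congr rfl fun σ _ => Finset.sum_comm, Finset.sum_comm]
        exact Finset.sum_congr rfl fun k _ => hε k
      rw [h2]
      simp
    · intro a b a' b'
      rw [Matrix.smul_apply, Matrix.sum_apply, smul_eq_mul, Matrix.of_apply, ← mul_ite_zero]
      congr 1
      rw [show (if b = b' then (∑ k, if (∀ k', k' ≠ k → pairEquiv r a k' = pairEquiv r a' k') then h (pairEquiv r a k) (pairEquiv r a' k) else 0) else 0) = ∑ k, (if b = b' then (if (∀ k', k' ≠ k → pairEquiv r a k' = pairEquiv r a' k') then h (pairEquiv r a k) (pairEquiv r a' k) else 0) else 0) by split_ifs <;> simp]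
      refine Finset.sum_congr rfl fun k _ => ?_
      have hk := k.isLt
      rw [hG, local_apply hn2 M hM]
      simp only [agree_iff hn0 (2 * (k : ℕ)) (by omega), pair_agree (show r + r ≤ n by omega) k]
      rw [← ite_and]
      have c1 : (2 * (k : ℕ)) % n = 2 * k := Nat.mod_eq_of_lt (by omega)
      have c2 : (1 + 2 * (k : ℕ)) % n = 2 * k + 1 := by
        rw [Nat.mod_eq_of_lt (by omega)]; omega
      simp only [shift_iter hn0, zero_add, c1, c2]
      simp [joinCfg, pairEquiv, show 2 * (k : ℕ) < r + r by omega, show 2 * (k : ℕ) + 1 < r + r by omega, hh]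
  have hT' := congrArg Complex.re hT
  rw [Complex.ofReal_re] at hT'
  have hent : entEntropy n (r + r) ψ + t * (r * ε) ≤ Real.log ((∑ y, Real.exp (t * x y)) ^ r) := by
    rw [← hT']; exact key
  have hpos : 0 < ∑ y, Real.exp (t * x y) :=
    Finset.sum_pos (fun y _ => Real.exp_pos _) Finset.univ_nonempty
  have hlog : Real.log (∑ y, Real.exp (t * x y)) ≤ 2 * Real.log 2 + t ^ 2 * N ^ 2 / 2 := by
    have h1 := Real.log_le_log hpos (hoeffding_sum x N t hN0 hx0 hxb)
    have h4 : (Fintype.card (Fin 2 × Fin 2) : ℝ) = 2 ^ 2 := by norm_num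
    rw [h4, Real.log_mul (by positivity) (Real.exp_pos _).ne', Real.log_exp, Real.log_pow] at h1
    exact_mod_cast h1
  rw [Real.log_pow] at hent
  have h6 : (r : ℝ) * Real.log (∑ y, Real.exp (t * x y)) ≤ r * (2 * Real.log 2 + t ^ 2 * N ^ 2 / 2) := by
    gcongr
  have h7 : (r : ℝ) * (2 * Real.log 2 + t ^ 2 * N ^ 2 / 2) - t * (r * ε) =
      ((r + r : ℕ) : ℝ) * Real.log 2 - ((r + r : ℕ) : ℝ) * ε ^ 2 / (4 * N ^ 2) := by
    push_cast
    by_cases hN1 : N = 0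
    · simp [ht, hN1]; ring
    · rw [ht]; field_simp; ring
  linarith

/-- Average eigenstate entanglement bound without the unit-norm assumption on the local
terms: `S̄ ≤ m ln 2 - f ⟨H₁²⟩ / (4 ‖H₁‖²)`, where `H₁` is an arbitrary nonzero traceless
local term of the translationally invariant Hamiltonian, `f = m/n ≤ 1/2`, `m` even. -/
theorem average_eigenstate_entanglement_upper_bound_general_norm
    (n m : ℕ) (hn : 0 < n) (hmeven : Even m) (hmn : 2 * m ≤ n)
    (H1 H2 : Fin n → QOp n)
    (hloc1 : ∀ i, ActsOn {i} (H1 i))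
    (hloc2 : ∀ i, ActsOn {i, finSucc i} (H2 i))
    (hherm1 : ∀ i, (H1 i).IsHermitian) (hherm2 : ∀ i, (H2 i).IsHermitian)
    (htr1 : ∀ i, (H1 i).trace = 0) (htr2 : ∀ i, (H2 i).trace = 0)
    (horth : ∀ i i', i ≠ i' → ((H1 i + H2 i) * (H1 i' + H2 i')).trace = 0)
    (hne : H1 ⟨0, hn⟩ + H2 ⟨0, hn⟩ ≠ 0)
    (hTIH1 : ∀ i σ τ, H1 (finSucc i) σ τ = H1 i (shiftCfg σ) (shiftCfg τ))
    (hTIH2 : ∀ i σ τ, H2 (finSucc i) σ τ = H2 i (shiftCfg σ) (shiftCfg τ))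
    (v : (Fin n → Fin 2) → QState n) (E : (Fin n → Fin 2) → ℝ)
    (hON : ∀ j j', ∑ σ, (starRingEnd ℂ) (v j σ) * v j' σ = if j = j' then 1 else 0)
    (heig : ∀ j, (∑ i, (H1 i + H2 i)).mulVec (v j) = (E j : ℂ) • v j)
    (hTIv : ∀ j, ∃ c : ℂ, ∀ σ, v j (shiftCfg σ) = c * v j σ) :
    (2 ^ n : ℝ)⁻¹ * ∑ j, entEntropy n m (v j)
      ≤ m * Real.log 2 -
        ((m : ℝ) / n) *
          ((((H1 ⟨0, hn⟩ + H2 ⟨0, hn⟩) * (H1 ⟨0, hn⟩ + H2 ⟨0, hn⟩)).trace).re / 2 ^ n) /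
          (4 * (opNorm (H1 ⟨0, hn⟩ + H2 ⟨0, hn⟩)) ^ 2) := by
  obtain ⟨r, rfl⟩ := hmeven
  set G : Fin n → QOp n := fun i => H1 i + H2 i with hGdef
  have hGTI : ∀ i σ τ, G (finSucc i) σ τ = G i (shiftCfg σ) (shiftCfg τ) := by
    intro i σ τ
    simp only [hGdef, Matrix.add_apply, hTIH1, hTIH2]
  have hnorm : ∀ j, ∑ σ, (starRingEnd ℂ) (v j σ) * v j σ = 1 := fun j => by
    rw [hON j j, if_pos rfl]
  have hd : (0 : ℝ) < 2 ^ n := by positivity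
  have hcard : (Fintype.card (Fin n → Fin 2) : ℝ) = 2 ^ n := by simp
  rcases Nat.eq_zero_or_pos r with hr | hr
  · subst hr
    have h0 : ∀ j, entEntropy n (0 + 0) (v j) ≤ 0 := by
      intro j
      have := vnEntropy_le (rdm n (0 + 0) (v j)) (rdm_psd _ _ _)
        (rdm_trace_one n (0 + 0) (by omega) (v j) (hnorm j)) (1 : Matrix (Fin (0 + 0) → Fin 2) (Fin (0 + 0) → Fin 2) ℂ) (by simp) (by simp) (fun _ => 0)
      simpa [entEntropy] using this
    have h1 : ∑ j, entEntropy n (0 + 0) (v j) ≤ 0 := Finset.sum_nonpos fun j _ => h0 j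
    have h2 : (2 ^ n : ℝ)⁻¹ * ∑ j, entEntropy n (0 + 0) (v j) ≤ 0 :=
      mul_nonpos_of_nonneg_of_nonpos (by positivity) h1
    simpa using h2
  change _ ≤ ((r + r : ℕ) : ℝ) * Real.log 2 - (((r + r : ℕ) : ℝ) / n) *
    (((G ⟨0, hn⟩ * G ⟨0, hn⟩).trace).re / 2 ^ n) / (4 * (opNorm (G ⟨0, hn⟩)) ^ 2)
  set M := G ⟨0, hn⟩ with hMdef
  have hsucc : finSucc (⟨0, hn⟩ : Fin n) = ⟨1, by omega⟩ := by
    ext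
    simp only [finSucc]
    exact Nat.mod_eq_of_lt (by omega)
  have hM : ActsOn {(⟨0, by omega⟩ : Fin n), ⟨1, by omega⟩} M := by
    have a2 := hloc2 ⟨0, hn⟩
    rw [hsucc] at a2
    exact ((hloc1 ⟨0, hn⟩).mono' (by simp)).add' a2
  have hMh : M.IsHermitian := (hherm1 _).add (hherm2 _)
  have hMt : M.trace = 0 := by
    rw [hMdef, hGdef, Matrix.trace_add, htr1, htr2, add_zero]
  -- all expectations agree
  have hex : ∀ j i, ∑ σ, ∑ τ, (starRingEnd ℂ) (v j σ) * G (finSucc i) σ τ * v j τ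
      = ∑ σ, ∑ τ, (starRingEnd ℂ) (v j σ) * G i σ τ * v j τ := by
    intro j i
    obtain ⟨c, hc⟩ := hTIv j
    have hcc : (starRingEnd ℂ) c * c = 1 := by
      have h1 := hnorm j
      rw [← shift_bij.sum_comp] at h1
      simp only [hc, map_mul] at h1
      have h2 : ∑ σ, (starRingEnd ℂ) c * (starRingEnd ℂ) (v j σ) * (c * v j σ)
          = (starRingEnd ℂ) c * c * ∑ σ, (starRingEnd ℂ) (v j σ) * v j σ := by
        rw [Finset.mul_sum]
        exact Finset.sum_congr rfl fun _ _ => by ring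
      rw [h2, hnorm j, mul_one] at h1
      exact h1
    symm
    rw [← shift_bij.sum_comp]
    refine Finset.sum_congr rfl fun σ _ => ?_
    rw [← shift_bij.sum_comp]
    refine Finset.sum_congr rfl fun τ _ => ?_
    rw [hGTI, hc, hc, map_mul]
    linear_combination ((starRingEnd ℂ) (v j σ) * G i (shiftCfg σ) (shiftCfg τ) * v j τ) * hcc
  have hex0 : ∀ j (k : ℕ), ∑ σ, ∑ τ, (starRingEnd ℂ) (v j σ) * G ⟨k % n, Nat.mod_lt _ hn⟩ σ τ * v j τ
      = ∑ σ, ∑ τ, (starRingEnd ℂ) (v j σ) * M σ τ * v j τ := by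
    intro j k
    induction k with
    | zero => simp [hMdef]
    | succ k ih =>
      have : (⟨(k + 1) % n, Nat.mod_lt _ hn⟩ : Fin n) = finSucc ⟨k % n, Nat.mod_lt _ hn⟩ := by
        simp [finSucc]
      rw [this, hex, ih]
  have hfin : ∀ i : Fin n, i = ⟨(i : ℕ) % n, Nat.mod_lt _ hn⟩ := fun i => by
    ext; exact (Nat.mod_eq_of_lt i.isLt).symm
  have hn' : (n : ℝ) ≠ 0 := by positivity
  have hexp : ∀ j i, ∑ σ, ∑ τ, (starRingEnd ℂ) (v j σ) * G i σ τ * v j τ = ((E j / n : ℝ) : ℂ) := by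
    intro j
    have h1 : ∑ i, ∑ σ, ∑ τ, (starRingEnd ℂ) (v j σ) * G i σ τ * v j τ = E j := by
      have h2 : ∀ σ, ∑ i, ∑ τ, G i σ τ * v j τ = E j * v j σ := by
        intro σ
        have := congrFun (heig j) σ
        simp only [mulVec, dotProduct, Pi.smul_apply, smul_eq_mul] at this
        rw [← this, Finset.sum_comm]
        refine Finset.sum_congr rfl fun τ _ => ?_
        rw [Matrix.sum_apply, Finset.sum_mul]
      rw [Finset.sum_comm]
      simp only [mul_assoc, ← Finset.mul_sum, h2]
      have h3 : ∀ σ, (starRingEnd ℂ) (v j σ) * ((E j : ℂ) * v j σ) = E j * ((starRingEnd ℂ) (v j σ) * v j σ) :=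
        fun σ => by ring
      simp only [h3, ← Finset.mul_sum, hnorm, mul_one]
    have h4 : ∀ i, ∑ σ, ∑ τ, (starRingEnd ℂ) (v j σ) * G i σ τ * v j τ
        = ∑ σ, ∑ τ, (starRingEnd ℂ) (v j σ) * M σ τ * v j τ := fun i => by
      rw [hfin i]; exact hex0 j i
    intro i
    rw [h4 i]
    simp only [h4, Finset.sum_const, Finset.card_univ, Fintype.card_fin, nsmul_eq_mul] at h1
    have hn'' : (n : ℂ) ≠ 0 := by exact_mod_cast hn.ne'
    push_cast
    rw [← h1]
    field_simp
  have hent : ∀ j, entEntropy n (r + r) (v j) ≤ ((r + r : ℕ) : ℝ) * Real.log 2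
      - ((r + r : ℕ) : ℝ) * (E j / n) ^ 2 / (4 * opNorm M ^ 2) := by
    intro j
    refine ent_bound hr hmn M hM hMh hMt (fun k => G ⟨(2 * (k : ℕ)) % n, Nat.mod_lt _ hn⟩) ?_ (v j) (hnorm j) (E j / n) ?_
    · intro k σ τ
      exact G_iter hn G hGTI _ σ τ
    · intro k
      exact hexp j _
  -- second moment
  have htrM : ∀ k : ℕ, (G ⟨k % n, Nat.mod_lt _ hn⟩ * G ⟨k % n, Nat.mod_lt _ hn⟩).trace = (M * M).trace := by
    intro k
    induction k with
    | zero => simp [hMdef]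
    | succ k ih =>
      have : (⟨(k + 1) % n, Nat.mod_lt _ hn⟩ : Fin n) = finSucc ⟨k % n, Nat.mod_lt _ hn⟩ := by
        simp [finSucc]
      rw [this, ← ih]
      simp only [trace, diag_apply, mul_apply, hGTI]
      rw [← shift_bij.sum_comp (fun σ => ∑ τ, G _ σ τ * G _ τ σ)]
      refine Finset.sum_congr rfl fun σ _ => ?_
      rw [← shift_bij.sum_comp (fun τ => G _ _ τ * G _ τ _)]
  have hHH : ((∑ i, G i) * (∑ i, G i)).trace = n * (M * M).trace := by
    rw [Finset.sum_mul, Matrix.trace_sum]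
    have : ∀ i, (G i * ∑ i', G i').trace = (M * M).trace := by
      intro i
      rw [Finset.mul_sum, Matrix.trace_sum, Finset.sum_eq_single i]
      · rw [hfin i]; exact htrM i
      · intro i' _ hi'
        exact horth i i' (Ne.symm hi')
      · simp
    simp [this]
  have hE2 : ∑ j, (E j) ^ 2 = n * (M * M).trace.re := by
    set V : QOp n := Matrix.of fun σ j => v j σ with hV
    have hV1 : Vᴴ * V = 1 := by
      ext j j'
      simp only [mul_apply, conjTranspose_apply, hV, of_apply, one_apply, RCLike.star_def]
      exact hON j j'
    have hV2 : V * Vᴴ = 1 := mul_eq_one_comm.mp hV1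
    have hHV : (∑ i, G i) * V = V * diagonal (fun j => (E j : ℂ)) := by
      ext σ j
      rw [mul_diagonal]
      have := congrFun (heig j) σ
      simp only [mulVec, dotProduct, Pi.smul_apply, smul_eq_mul] at this
      rw [mul_apply]
      simp only [hV, of_apply]
      rw [mul_comm, ← this]
    have h1 : ((∑ i, G i) * (∑ i, G i)).trace = ((∑ j, (E j) ^ 2 : ℝ) : ℂ) := by
      calc ((∑ i, G i) * (∑ i, G i)).trace = ((∑ i, G i) * ((∑ i, G i) * V) * Vᴴ).trace := by
            rw [Matrix.mul_assoc, Matrix.mul_assoc, hV2, Matrix.mul_one]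
        _ = (V * diagonal (fun j => (E j : ℂ)) * diagonal (fun j => (E j : ℂ)) * Vᴴ).trace := by
            rw [hHV, ← Matrix.mul_assoc, hHV]
        _ = (diagonal (fun j => (E j : ℂ)) * diagonal (fun j => (E j : ℂ))).trace := by
            rw [Matrix.trace_mul_comm, ← Matrix.mul_assoc, ← Matrix.mul_assoc, hV1, Matrix.one_mul]
        _ = _ := by
            rw [diagonal_mul_diagonal, trace_diagonal]
            push_cast
            exact Finset.sum_congr rfl fun _ _ => by ring
    rw [hHH] at h1
    have h2 := congrArg Complex.re h1
    rw [Complex.ofReal_re] at h2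
    rw [← h2]
    simp
  have hsum : ∑ j, entEntropy n (r + r) (v j) ≤ 2 ^ n * (((r + r : ℕ) : ℝ) * Real.log 2)
      - ((r + r : ℕ) : ℝ) / n ^ 2 / (4 * opNorm M ^ 2) * (n * (M * M).trace.re) := by
    refine (Finset.sum_le_sum fun j _ => hent j).trans (le_of_eq ?_)
    rw [Finset.sum_sub_distrib, Finset.sum_const, Finset.card_univ, nsmul_eq_mul, hcard, ← hE2, Finset.mul_sum]
    congr 1
    refine Finset.sum_congr rfl fun j _ => ?_
    rw [div_pow]
    ring
  calc (2 ^ n : ℝ)⁻¹ * ∑ j, entEntropy n (r + r) (v j)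
      ≤ (2 ^ n : ℝ)⁻¹ * (2 ^ n * (((r + r : ℕ) : ℝ) * Real.log 2)
      - ((r + r : ℕ) : ℝ) / n ^ 2 / (4 * opNorm M ^ 2) * (n * (M * M).trace.re)) := by gcongr
    _ = _ := by
      rw [mul_sub, inv_mul_cancel_left₀ hd.ne']
      congr 1
      field_simp
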